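/- arXiv:1711.09441 — 2 statements merged into one kernel-verified Lean document; each statement's English description precedes it below -/
import Mathlib

section
/- The function h : (0,∞) → (0,1) given by h(x) = x/(1+x) is a strictly increasing bijection from the positive reals onto the open unit interval satisfying h(x·y) = h(x) ⊗ h(y) for all x,y > 0, where a ⊗ b = a·b / (a·b + (1−a)·(1−b)). Hence h is an isomorphism of linearly ordered commutative groups from the multiplicative Alo-group ((0,∞), ·, ≤) to the fuzzy Alo-group ((0,1), ⊗, ≤). -/
/-- The fuzzy (Yager–Rybalov) operation on the open unit interval. -/
noncomputable def fop (a b : ℝ) : ℝ := a * b / (a * b + (1 - a) * (1 - b))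

/-- `h(x) = x/(1+x)` is a strictly increasing bijection from `(0,∞)` onto
`(0,1)` mapping multiplication to the fuzzy operation `⊗`; i.e. it is an isomorphism from
the multiplicative Alo-group to the fuzzy Alo-group. -/
theorem mult_to_fuzzy_isomorphism :
    Set.BijOn (fun x : ℝ => x / (1 + x)) (Set.Ioi 0) (Set.Ioo 0 1) ∧
    StrictMonoOn (fun x : ℝ => x / (1 + x)) (Set.Ioi 0) ∧
    (∀ x y : ℝ, 0 < x → 0 < y →
      (x * y) / (1 + x * y) = fop (x / (1 + x)) (y / (1 + y))) := by
  have mono : StrictMonoOn (fun x : ℝ => x / (1 + x)) (Set.Ioi 0) := by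
    intro x hx y hy hxy
    simp only [Set.mem_Ioi] at hx hy
    change x / (1 + x) < y / (1 + y)
    rw [div_lt_div_iff₀ (by linarith) (by linarith)]
    linarith
  refine ⟨⟨?_, mono.injOn, ?_⟩, mono, ?_⟩
  · intro x hx
    simp only [Set.mem_Ioi] at hx
    exact ⟨by positivity, (div_lt_one (by linarith)).2 (by linarith)⟩
  · rintro y ⟨hy0, hy1⟩
    have hy : 0 < 1 - y := sub_pos.2 hy1
    refine ⟨y / (1 - y), div_pos hy0 hy, ?_⟩
    have h : 1 + y / (1 - y) = 1 / (1 - y) := by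
      field_simp
      ring
    change y / (1 - y) / (1 + y / (1 - y)) = y
    rw [h]
    field_simp
  · intro x y hx hy
    have hx' : 1 - x / (1 + x) = 1 / (1 + x) := by
      field_simp
      ring
    have hy' : 1 - y / (1 + y) = 1 / (1 + y) := by
      field_simp
      ring
    rw [fop, hx', hy']
    field_simp
    ring
end

section
/- The function g : ℝ → (0,1) given by g(x) = eˣ/(1+eˣ) is a strictly increasing bijection from the reals onto the open unit interval satisfying g(x+y) = g(x) ⊗ g(y) for all x,y ∈ ℝ, where a ⊗ b = a·b / (a·b + (1−a)·(1−b)). Hence g is an isomorphism of linearly ordered commutative groups from the additive Alo-group (ℝ, +, ≤) to the fuzzy Alo-group ((0,1), ⊗, ≤). -/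
theorem strictMono_exp_div_one_add_exp :
    StrictMono (fun x : ℝ => Real.exp x / (1 + Real.exp x)) := by
  intro x y hxy
  have hx := Real.exp_pos x
  have hy := Real.exp_pos y
  have h := Real.exp_lt_exp.mpr hxy
  simp only
  rw [div_lt_div_iff₀ (by positivity) (by positivity)]
  linarith

theorem bijOn_exp_div_one_add_exp :
    Set.BijOn (fun x : ℝ => Real.exp x / (1 + Real.exp x)) Set.univ (Set.Ioo 0 1) := by
  refine ⟨fun x _ => ⟨by positivity, ?_⟩, strictMono_exp_div_one_add_exp.injective.injOn, ?_⟩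
  · have hx := Real.exp_pos x
    simp only
    rw [div_lt_one (by positivity)]
    linarith
  · rintro a ⟨h0, h1⟩
    have h2 : 0 < 1 - a := sub_pos.mpr h1
    refine ⟨Real.log (a / (1 - a)), Set.mem_univ _, ?_⟩
    simp only
    rw [Real.exp_log (div_pos h0 h2)]
    field_simp
    ring

theorem fop_div_one_add {s t : ℝ} (hs : 0 < s) (ht : 0 < t) :
    fop (s / (1 + s)) (t / (1 + t)) = s * t / (1 + s * t) := by
  have h (r : ℝ) (hr : 0 < r) : 1 - r / (1 + r) = 1 / (1 + r) := by
    field_simp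
    ring
  rw [fop, h s hs, h t ht]
  field_simp
  ring

/-- `g(x) = eˣ/(1+eˣ)` is a strictly increasing bijection from `ℝ` onto
`(0,1)` mapping addition to the fuzzy operation `⊗`; i.e. it is an isomorphism from the
additive Alo-group to the fuzzy Alo-group. -/
theorem add_to_fuzzy_isomorphism :
    StrictMono (fun x : ℝ => Real.exp x / (1 + Real.exp x)) ∧
    Set.BijOn (fun x : ℝ => Real.exp x / (1 + Real.exp x)) Set.univ (Set.Ioo 0 1) ∧
    (∀ x y : ℝ, Real.exp (x + y) / (1 + Real.exp (x + y)) =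
      fop (Real.exp x / (1 + Real.exp x)) (Real.exp y / (1 + Real.exp y))) := by
  refine ⟨strictMono_exp_div_one_add_exp, bijOn_exp_div_one_add_exp, fun x y => ?_⟩
  rw [fop_div_one_add (Real.exp_pos x) (Real.exp_pos y), Real.exp_add]
end
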